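/- Let (X,d) and (X',d') be metric spaces, α ∈ (0,1], c ≥ 0, H ≥ 0, and let (y_i)_{i∈ι} be a countable family of maps y_i : X' → X with d(y_i(x), y_i(x')) ≤ c·d'(x,x') for all i and x,x' ∈ X'. Let φ : X → ℝ satisfy |φ(y_i(x)) − φ(y_i(x'))| ≤ H·d'(x,x')^α for all i and x,x' ∈ X', and assume that for every x ∈ X' the family (e^{φ(y_i(x))})_{i∈ι} is summable with ℒ1(x) := ∑_i e^{φ(y_i(x))} and that M := sup_{x∈X'} ℒ1(x) < ∞. Then for every bounded g : X → ℝ with finite α-Hölder seminorm v_α(g), the sum ℒg(x) := ∑_i e^{φ(y_i(x))}·g(y_i(x)) converges absolutely for every x, sup_{X'}|ℒg| ≤ M·sup_X|g|, the α-Hölder seminorm satisfies v_α(ℒg) ≤ (c^α·v_α(g) + 2H·sup_X|g|)·M, and consequently sup_{X'}|ℒg| + v_α(ℒg) ≤ (1 + 2H + c^α)·M·(sup_X|g| + v_α(g)). -/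

import Mathlib

/-- The α-Hölder seminorm of `h`, defined as the least nonnegative constant `C`
with `|h x - h x'| ≤ C · d(x,x')^α` (junk value `0` if no such constant exists). -/
noncomputable def vHolder {X : Type*} [PseudoMetricSpace X] (α : ℝ) (h : X → ℝ) : ℝ :=
  sInf {C : ℝ | 0 ≤ C ∧ ∀ x x', |h x - h x'| ≤ C * dist x x' ^ α}

theorem vHolder_nonneg {X : Type*} [PseudoMetricSpace X] (α : ℝ) (h : X → ℝ) :
    0 ≤ vHolder α h :=
  Real.sInf_nonneg fun _ hC => hC.1

theorem vHolder_le {X : Type*} [PseudoMetricSpace X] {α : ℝ} {h : X → ℝ} {C : ℝ} (hC : 0 ≤ C)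
    (hh : ∀ x x', |h x - h x'| ≤ C * dist x x' ^ α) : vHolder α h ≤ C :=
  csInf_le ⟨0, fun _ hD => hD.1⟩ ⟨hC, hh⟩

/-- The infimum defining the Hölder seminorm is attained. -/
theorem abs_sub_le_vHolder_mul {X : Type*} [PseudoMetricSpace X] {α : ℝ} {h : X → ℝ}
    (hh : ∃ C : ℝ, 0 ≤ C ∧ ∀ x x', |h x - h x'| ≤ C * dist x x' ^ α) (x x' : X) :
    |h x - h x'| ≤ vHolder α h * dist x x' ^ α := by
  rcases (Real.rpow_nonneg (dist_nonneg (x := x) (y := x')) α).eq_or_lt with h0 | hpos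
  · obtain ⟨C, -, hC⟩ := hh
    simpa [← h0] using hC x x'
  · rw [← div_le_iff₀ hpos]
    exact le_csInf hh fun C hC => (div_le_iff₀ hpos).2 (hC.2 x x')

theorem abs_exp_sub_exp_le (a b : ℝ) :
    |Real.exp a - Real.exp b| ≤ |a - b| * (Real.exp a + Real.exp b) := by
  have key (s t : ℝ) : Real.exp s - Real.exp t ≤ |s - t| * (Real.exp s + Real.exp t) := by
    have h₁ : Real.exp t = Real.exp s * Real.exp (t - s) := by
      rw [← Real.exp_add, add_sub_cancel]
    have h₂ : Real.exp s * (t - s + 1) ≤ Real.exp t := by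
      rw [h₁]
      exact mul_le_mul_of_nonneg_left (Real.add_one_le_exp _) (Real.exp_pos s).le
    have h₃ := mul_le_mul_of_nonneg_right (le_abs_self (s - t)) (Real.exp_pos s).le
    have h₄ := mul_nonneg (abs_nonneg (s - t)) (Real.exp_pos t).le
    linarith
  refine abs_le.2 ⟨?_, key a b⟩
  have h := key b a
  rw [abs_sub_comm] at h
  linarith

/-- operator norm bound for the transfer operator
`ℒg(x) = ∑_i e^{φ(y_i(x))} g(y_i(x))`: absolute convergence, sup-norm bound,
Hölder-variation bound, and `‖ℒg‖_α ≤ (1 + 2H + c^α)·M·‖g‖_α`. -/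
theorem stmt_18 {X X' ι : Type*} [MetricSpace X] [MetricSpace X'] [Nonempty X] [Nonempty X']
    [Countable ι]
    (α : ℝ) (hα : α ∈ Set.Ioc (0 : ℝ) 1) (c H : ℝ) (hc : 0 ≤ c) (hH : 0 ≤ H)
    (y : ι → X' → X)
    (hy : ∀ (i : ι) (x x' : X'), dist (y i x) (y i x') ≤ c * dist x x')
    (φ : X → ℝ)
    (hφ : ∀ (i : ι) (x x' : X'), |φ (y i x) - φ (y i x')| ≤ H * dist x x' ^ α)
    (hsum : ∀ x : X', Summable fun i => Real.exp (φ (y i x)))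
    (M : ℝ) (hM : ∀ x : X', (∑' i, Real.exp (φ (y i x))) ≤ M)
    (g : X → ℝ) (hgbdd : BddAbove (Set.range fun x => |g x|))
    (hgH : ∃ C : ℝ, 0 ≤ C ∧ ∀ u u' : X, |g u - g u'| ≤ C * dist u u' ^ α) :
    (∀ x : X', Summable fun i => Real.exp (φ (y i x)) * g (y i x)) ∧
      (∀ x : X', |∑' i, Real.exp (φ (y i x)) * g (y i x)| ≤ M * ⨆ u, |g u|) ∧
      (∀ x x' : X',
        |(∑' i, Real.exp (φ (y i x)) * g (y i x)) -
            ∑' i, Real.exp (φ (y i x')) * g (y i x')| ≤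
          (c ^ α * vHolder α g + 2 * H * ⨆ u, |g u|) * M * dist x x' ^ α) ∧
      (⨆ x : X', |∑' i, Real.exp (φ (y i x)) * g (y i x)|) +
          vHolder α (fun x : X' => ∑' i, Real.exp (φ (y i x)) * g (y i x)) ≤
        (1 + 2 * H + c ^ α) * M * ((⨆ u, |g u|) + vHolder α g) := by
  obtain ⟨x₀⟩ := ‹Nonempty X'›
  obtain ⟨u₀⟩ := ‹Nonempty X›
  set S := ⨆ u, |g u|
  set V := vHolder α g
  have hgS (u : X) : |g u| ≤ S := le_ciSup hgbdd u
  have hS0 : 0 ≤ S := (abs_nonneg _).trans (hgS u₀)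
  have hV0 : 0 ≤ V := vHolder_nonneg α g
  have hM0 : 0 ≤ M := (tsum_nonneg fun i => (Real.exp_pos _).le).trans (hM x₀)
  have hcα : 0 ≤ c ^ α := Real.rpow_nonneg hc α
  have hterm (x : X') (i : ι) :
      ‖Real.exp (φ (y i x)) * g (y i x)‖ ≤ Real.exp (φ (y i x)) * S := by
    rw [Real.norm_eq_abs, abs_mul, Real.abs_exp]
    exact mul_le_mul_of_nonneg_left (hgS _) (Real.exp_pos _).le
  have hsummable (x : X') : Summable fun i => Real.exp (φ (y i x)) * g (y i x) :=
    .of_norm_bounded ((hsum x).mul_right S) (hterm x)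
  have hsup (x : X') : |∑' i, Real.exp (φ (y i x)) * g (y i x)| ≤ M * S :=
    (tsum_of_norm_bounded ((hsum x).hasSum.mul_right S) (hterm x)).trans
      (mul_le_mul_of_nonneg_right (hM x) hS0)
  have hdiff (x x' : X') (i : ι) :
      ‖Real.exp (φ (y i x)) * g (y i x) - Real.exp (φ (y i x')) * g (y i x')‖ ≤
        Real.exp (φ (y i x)) * (c ^ α * V * dist x x' ^ α) +
          (Real.exp (φ (y i x)) + Real.exp (φ (y i x'))) * (H * S * dist x x' ^ α) := by
    have hg : |g (y i x) - g (y i x')| ≤ c ^ α * V * dist x x' ^ α := by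
      calc |g (y i x) - g (y i x')| ≤ V * dist (y i x) (y i x') ^ α :=
            abs_sub_le_vHolder_mul hgH _ _
        _ ≤ V * (c * dist x x') ^ α := by
            gcongr
            · exact hα.1.le
            · exact hy i x x'
        _ = c ^ α * V * dist x x' ^ α := by
            rw [Real.mul_rpow hc dist_nonneg]
            ring
    have he : |Real.exp (φ (y i x)) - Real.exp (φ (y i x'))| ≤
        H * dist x x' ^ α * (Real.exp (φ (y i x)) + Real.exp (φ (y i x'))) :=
      (abs_exp_sub_exp_le _ _).trans (mul_le_mul_of_nonneg_right (hφ i x x') (by positivity))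
    calc ‖Real.exp (φ (y i x)) * g (y i x) - Real.exp (φ (y i x')) * g (y i x')‖
        = |Real.exp (φ (y i x)) * (g (y i x) - g (y i x')) +
            (Real.exp (φ (y i x)) - Real.exp (φ (y i x'))) * g (y i x')| := by
          rw [Real.norm_eq_abs]
          ring_nf
      _ ≤ Real.exp (φ (y i x)) * |g (y i x) - g (y i x')| +
            |Real.exp (φ (y i x)) - Real.exp (φ (y i x'))| * |g (y i x')| := by
          refine (abs_add_le _ _).trans_eq ?_
          rw [abs_mul, abs_mul, Real.abs_exp]
      _ ≤ Real.exp (φ (y i x)) * (c ^ α * V * dist x x' ^ α) +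
            H * dist x x' ^ α * (Real.exp (φ (y i x)) + Real.exp (φ (y i x'))) * S := by
          gcongr
          exact hgS _
      _ = _ := by ring
  have hholder (x x' : X') :
      |(∑' i, Real.exp (φ (y i x)) * g (y i x)) - ∑' i, Real.exp (φ (y i x')) * g (y i x')| ≤
        (c ^ α * V + 2 * H * S) * M * dist x x' ^ α := by
    rw [← (hsummable x).tsum_sub (hsummable x')]
    calc |∑' i, (Real.exp (φ (y i x)) * g (y i x) - Real.exp (φ (y i x')) * g (y i x'))|
        ≤ (∑' i, Real.exp (φ (y i x))) * (c ^ α * V * dist x x' ^ α) +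
            ((∑' i, Real.exp (φ (y i x))) + ∑' i, Real.exp (φ (y i x'))) *
              (H * S * dist x x' ^ α) :=
          tsum_of_norm_bounded (((hsum x).hasSum.mul_right _).add
            (((hsum x).hasSum.add (hsum x').hasSum).mul_right _)) (hdiff x x')
      _ ≤ M * (c ^ α * V * dist x x' ^ α) + (M + M) * (H * S * dist x x' ^ α) := by
          gcongr
          exacts [hM x, hM x, hM x']
      _ = _ := by ring
  refine ⟨hsummable, hsup, hholder, ?_⟩
  have : Nonempty X' := ⟨x₀⟩
  have h₁ := ciSup_le hsup
  have h₂ := vHolder_le (by positivity) hholder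
  have h₃ : 0 ≤ M * (V + 2 * H * V + c ^ α * S) := by positivity
  linarith
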